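/- For every n ≥ 1 there exists a real constant k₀ > 0 such that every n×n complex matrix A which is symmetric (Aᵀ = A) and nilpotent satisfies tr([A, Aᴴ]·[A, Aᴴ]ᴴ) ≥ k₀ · (tr(A·Aᴴ))² (both sides being nonnegative real numbers). This follows from the bound on the compact set of normalized symmetric nilpotent matrices together with the scaling invariance ρ(λA) = ρ(A) for λ > 0 of the quotient ρ(A) = -tr([A, Aᴴ]·[A, Aᴴ]ᴴ)/tr(A·Aᴴ)², and is the analytic core of the negative bound on the holomorphic sectional curvature of the canonical CV-metric near irreducible points. -/

import Mathlib

open Matrix ComplexOrder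

lemma aux_tr {n : ℕ} (A : Matrix (Fin n) (Fin n) ℂ) :
    (A * Aᴴ).trace = ((∑ i, ∑ j, ‖A i j‖ ^ 2 : ℝ) : ℂ) := by
  simp [Matrix.trace, Matrix.mul_apply, Complex.mul_conj, Complex.normSq_eq_norm_sq]

lemma aux_pow {n : ℕ} (A : Matrix (Fin n) (Fin n) ℂ) (h : IsNilpotent A) : A ^ n = 0 := by
  have h1 := (Matrix.isNilpotent_charpoly_sub_pow_of_isNilpotent h).eq_zero
  have h2 := Matrix.aeval_self_charpoly A
  rw [sub_eq_zero] at h1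
  rw [h1] at h2
  simpa using h2

lemma aux_herm {n : ℕ} (H : Matrix (Fin n) (Fin n) ℂ) (hH : Hᴴ = H) (k : ℕ)
    (h : H ^ (2 ^ k) = 0) : H = 0 := by
  induction k with
  | zero => simpa using h
  | succ k ih =>
    apply ih
    rw [← Matrix.self_mul_conjTranspose_eq_zero, Matrix.conjTranspose_pow, hH, ← pow_add]
    rw [pow_succ, mul_two] at h
    exact h

lemma aux_normal {n : ℕ} (A : Matrix (Fin n) (Fin n) ℂ) (h : A ^ n = 0)
    (hc : A * Aᴴ = Aᴴ * A) : A = 0 := by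
  rw [← Matrix.self_mul_conjTranspose_eq_zero]
  apply aux_herm _ (by simp) n
  have hc' : Commute A Aᴴ := hc
  rw [hc'.mul_pow, pow_eq_zero_of_le (Nat.lt_two_pow_self).le h, zero_mul]

noncomputable def auxF {n : ℕ} (A : Matrix (Fin n) (Fin n) ℂ) : ℝ := ∑ i, ∑ j, ‖A i j‖ ^ 2

lemma auxF_cont {n : ℕ} : Continuous (auxF (n := n)) := by
  unfold auxF
  fun_prop

lemma auxF_nonneg {n : ℕ} (A : Matrix (Fin n) (Fin n) ℂ) : 0 ≤ auxF A := by
  unfold auxF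
  positivity

lemma auxF_eq_zero {n : ℕ} (A : Matrix (Fin n) (Fin n) ℂ) (h : auxF A = 0) : A = 0 := by
  rw [← Matrix.trace_mul_conjTranspose_self_eq_zero_iff, aux_tr]
  exact_mod_cast h

lemma auxF_smul {n : ℕ} (c : ℝ) (A : Matrix (Fin n) (Fin n) ℂ) :
    auxF ((c : ℂ) • A) = c ^ 2 * auxF A := by
  simp [auxF, mul_pow, Finset.mul_sum]

lemma aux_compact (n : ℕ) :
    IsCompact {A : Matrix (Fin n) (Fin n) ℂ | A ^ n = 0 ∧ auxF A = 1} := by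
  have hK : IsCompact (Set.pi Set.univ
      (fun _ : Fin n => Set.pi Set.univ (fun _ : Fin n => Metric.closedBall (0:ℂ) 1))) :=
    isCompact_univ_pi fun _ => isCompact_univ_pi fun _ => isCompact_closedBall _ _
  refine IsCompact.of_isClosed_subset (X := Matrix (Fin n) (Fin n) ℂ) hK ?_ ?_
  · exact (isClosed_eq (continuous_id.pow n) continuous_const).inter
      (isClosed_eq auxF_cont continuous_const)
  · rintro A ⟨-, hA⟩ i - j -
    rw [mem_closedBall_zero_iff]
    have h1 : ‖A i j‖ ^ 2 ≤ ∑ j, ‖A i j‖ ^ 2 :=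
      Finset.single_le_sum (f := fun j => ‖A i j‖ ^ 2) (fun _ _ => by positivity)
        (Finset.mem_univ j)
    have h2 : ∑ j, ‖A i j‖ ^ 2 ≤ auxF A :=
      Finset.single_le_sum (f := fun i => ∑ j, ‖A i j‖ ^ 2) (fun _ _ => by positivity)
        (Finset.mem_univ i)
    have h3 : ‖A i j‖ ^ 2 ≤ 1 := by linarith
    exact (sq_le_one_iff₀ (norm_nonneg _)).1 h3

lemma aux_main (n : ℕ) : ∃ k : ℝ, 0 < k ∧ ∀ A : Matrix (Fin n) (Fin n) ℂ,
    A ^ n = 0 → auxF A = 1 → k ≤ auxF (A * Aᴴ - Aᴴ * A) := by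
  rcases Set.eq_empty_or_nonempty {A : Matrix (Fin n) (Fin n) ℂ | A ^ n = 0 ∧ auxF A = 1}
    with he | hne
  · refine ⟨1, one_pos, fun A h1 h2 => ?_⟩
    have : A ∈ {A : Matrix (Fin n) (Fin n) ℂ | A ^ n = 0 ∧ auxF A = 1} := ⟨h1, h2⟩
    rw [he] at this
    exact this.elim
  · have hc : Continuous fun A : Matrix (Fin n) (Fin n) ℂ => auxF (A * Aᴴ - Aᴴ * A) :=
      auxF_cont.comp (by fun_prop)
    obtain ⟨B, ⟨hB, hB1⟩, hmin⟩ := (aux_compact n).exists_isMinOn hne hc.continuousOn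
    refine ⟨_, lt_of_le_of_ne (auxF_nonneg (B * Bᴴ - Bᴴ * B)) ?_, fun A h1 h2 => hmin ⟨h1, h2⟩⟩
    intro h0
    have := aux_normal B hB (sub_eq_zero.1 (auxF_eq_zero _ h0.symm))
    subst this
    simp [auxF] at hB1

/-- For every `n ≥ 1` there is `k₀ > 0` such that every symmetric nilpotent `n × n`
complex matrix `A` satisfies `tr ([A, Aᴴ] * [A, Aᴴ]ᴴ) ≥ k₀ * (tr (A * Aᴴ))²` (both
sides are nonnegative real numbers). This is the analytic core of the negative bound on
the holomorphic sectional curvature of the canonical CV-metric near irreducible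
points. -/
theorem exists_uniform_bound_on_symmetric_nilpotent
    (n : ℕ) (hn : 1 ≤ n) :
    ∃ k₀ : ℝ, 0 < k₀ ∧
      ∀ A : Matrix (Fin n) (Fin n) ℂ,
        Aᵀ = A → IsNilpotent A →
        (k₀ : ℂ) * ((A * Aᴴ).trace) ^ 2 ≤
          ((A * Aᴴ - Aᴴ * A) * (A * Aᴴ - Aᴴ * A)ᴴ).trace := by
  obtain ⟨k, hk, h⟩ := aux_main n
  refine ⟨k, hk, fun A _ hA => ?_⟩
  rw [aux_tr, aux_tr]
  change (k : ℂ) * ((auxF A : ℝ) : ℂ) ^ 2 ≤ ((auxF (A * Aᴴ - Aᴴ * A) : ℝ) : ℂ)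
  norm_cast
  rcases (auxF_nonneg A).eq_or_lt with h0 | h0
  · rw [← h0]
    simpa using auxF_nonneg _
  · set c : ℝ := (Real.sqrt (auxF A))⁻¹ with hc
    have hc2 : c ^ 2 = (auxF A)⁻¹ := by rw [hc, inv_pow, Real.sq_sqrt h0.le]
    have key := h ((c : ℂ) • A) (by rw [smul_pow, aux_pow A hA, smul_zero])
      (by rw [auxF_smul, hc2, inv_mul_cancel₀ h0.ne'])
    have e : ((c : ℂ) • A) * ((c : ℂ) • A)ᴴ - ((c : ℂ) • A)ᴴ * ((c : ℂ) • A)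
        = ((c ^ 2 : ℝ) : ℂ) • (A * Aᴴ - Aᴴ * A) := by
      simp [Matrix.conjTranspose_smul, smul_smul, smul_sub, sq]
      ext i j
      simp
    rw [e, auxF_smul, hc2, inv_pow] at key
    rw [inv_mul_eq_div, le_div_iff₀ (by positivity)] at key
    exact key
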